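/- For every integer t ≥ 2 there is a constant D_t > 0 such that for every n ≥ 1 there exists a definite t-program P with |At(P)| ≤ n having at least D_t · binomial(2t−1, t)^{n/(2t−1)} stable models (the exponent n/(2t−1) is a real number). -/

import Mathlib

/-- A clause of a propositional logic program: an optional head (a definite
clause if `head = some h`, a constraint if `head = none`), a positive body
and a negative body. -/
structure LPClause (α : Type) where
  head : Option α
  pos : Finset α
  neg : Finset α
deriving DecidableEq

/-- A program is a finite set of clauses. -/
abbrev LPProgram (α : Type) := Finset (LPClause α)

/-- The atoms occurring in a clause. -/
def LPClause.atoms {α : Type} [DecidableEq α] (c : LPClause α) : Finset α :=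
  c.head.toFinset ∪ c.pos ∪ c.neg

/-- The atoms occurring in a program. -/
def LPProgram.atoms {α : Type} [DecidableEq α] (P : LPProgram α) : Finset α :=
  P.sup LPClause.atoms

/-- `N` is closed under the Horn rules of the reduct `P^M`: for every definite
clause of `P` whose negative body is disjoint from `M`, if its positive body
is contained in `N` then so is its head. -/
def ClosedUnder {α : Type} (P : LPProgram α) (M : Finset α) (N : Set α) : Prop :=
  ∀ c ∈ P, ∀ h : α, c.head = some h → (∀ b ∈ c.neg, b ∉ M) →
    (↑c.pos : Set α) ⊆ N → h ∈ N

/-- `M` is a stable model of `P`: `M` is the least set closed under the rules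
of the reduct `P^M` (i.e. `M = lm(P^M)`), and `M` satisfies every constraint
of `P`. -/
def IsStable {α : Type} (P : LPProgram α) (M : Finset α) : Prop :=
  ClosedUnder P M ↑M ∧ (∀ N : Set α, ClosedUnder P M N → ↑M ⊆ N) ∧
  ∀ c ∈ P, c.head = none → ¬(c.pos ⊆ M ∧ ∀ b ∈ c.neg, b ∉ M)

/-- `P` is a `t`-program: every clause has at most `t` literals, counting the head. -/
def IsTProgram {α : Type} (P : LPProgram α) (t : ℕ) : Prop :=
  ∀ c ∈ P, c.pos.card + c.neg.card + (c.head.elim 0 fun _ => 1) ≤ t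

/-- The `i`-th interval of `m` consecutive natural numbers. -/
def atomBlock (m i : ℕ) : Finset ℕ := Finset.Ico (i * m) (i * m + m)

theorem card_atomBlock (m i : ℕ) : (atomBlock m i).card = m := by
  simp [atomBlock]

theorem mem_atomBlock {m : ℕ} (hm : 0 < m) {i x : ℕ} : x ∈ atomBlock m i ↔ x / m = i := by
  rw [atomBlock, Finset.mem_Ico, Nat.div_eq_iff hm]
  lia

/-- The clauses `x ← not B` over `q` blocks of `m` atoms, where `B` ranges over the `k`-subsets of
the block of `x` that do not contain `x`. -/
def blockProgram (m k q : ℕ) : LPProgram ℕ :=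
  (Finset.range (q * m)).biUnion fun x =>
    (((atomBlock m (x / m)).erase x).powersetCard k).image fun B => ⟨some x, ∅, B⟩

theorem mem_blockProgram {m k q : ℕ} {c : LPClause ℕ} :
    c ∈ blockProgram m k q ↔ ∃ x < q * m, ∃ B ⊆ (atomBlock m (x / m)).erase x,
      B.card = k ∧ c = ⟨some x, ∅, B⟩ := by
  simp only [blockProgram, Finset.mem_biUnion, Finset.mem_range, Finset.mem_image,
    Finset.mem_powersetCard, and_assoc, eq_comm]

theorem isTProgram_blockProgram (m k q : ℕ) : IsTProgram (blockProgram m k q) (k + 1) := by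
  intro c hc
  obtain ⟨x, -, B, -, hB, rfl⟩ := mem_blockProgram.1 hc
  simp [hB]

theorem atomBlock_subset_range {m q i : ℕ} (hi : i < q) :
    atomBlock m i ⊆ Finset.range (q * m) := by
  intro y hy
  rw [atomBlock, Finset.mem_Ico] at hy
  rw [Finset.mem_range]
  nlinarith

theorem atoms_blockProgram_subset {m k q : ℕ} :
    (blockProgram m k q).atoms ⊆ Finset.range (q * m) := by
  refine Finset.sup_le fun c hc => ?_
  obtain ⟨x, hx, B, hB, -, rfl⟩ := mem_blockProgram.1 hc
  have hBx : B ⊆ Finset.range (q * m) :=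
    (hB.trans (Finset.erase_subset _ _)).trans
      (atomBlock_subset_range (Nat.div_lt_of_lt_mul (by rwa [mul_comm])))
  intro y hy
  simp only [LPClause.atoms, Option.toFinset_some, Finset.union_empty, Finset.mem_union,
    Finset.mem_singleton] at hy
  rcases hy with rfl | hy
  · exact Finset.mem_range.2 hx
  · exact hBx hy

theorem finite_setOf_isStable_blockProgram (m k q : ℕ) :
    {M : Finset ℕ | IsStable (blockProgram m k q) M}.Finite := by
  refine (Finset.range (q * m)).powerset.finite_toSet.subset fun M hM => ?_
  have hsub : (↑M : Set ℕ) ⊆ ↑(Finset.range (q * m)) := by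
    refine hM.2.1 _ fun c hc h hh _ _ => ?_
    obtain ⟨x, hx, B, -, -, rfl⟩ := mem_blockProgram.1 hc
    obtain rfl : x = h := by simpa using hh
    simpa using hx
  simpa using hsub

/-- A set meeting every block in all but `k` atoms is a stable model. -/
theorem isStable_blockProgram {m k q : ℕ} (hm : 0 < m) {M : Finset ℕ}
    (hM : M ⊆ Finset.range (q * m)) (hcard : ∀ i < q, (atomBlock m i \ M).card = k) :
    IsStable (blockProgram m k q) M := by
  refine ⟨?_, ?_, ?_⟩
  · intro c hc h hh hneg _
    obtain ⟨x, hx, B, hB, hBk, rfl⟩ := mem_blockProgram.1 hc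
    obtain rfl : x = h := by simpa using hh
    by_contra hxM
    have hxM : x ∉ M := by simpa using hxM
    have hss : B ⊂ atomBlock m (x / m) \ M := by
      refine (Finset.ssubset_iff_of_subset fun y hy => ?_).2
        ⟨x, Finset.mem_sdiff.2 ⟨(mem_atomBlock hm).2 rfl, hxM⟩, fun hxB => ?_⟩
      · exact Finset.mem_sdiff.2 ⟨Finset.mem_of_mem_erase (hB hy), hneg y hy⟩
      · exact Finset.notMem_erase _ _ (hB hxB)
    have := Finset.card_lt_card hss
    rw [hBk, hcard _ (Nat.div_lt_of_lt_mul (by rwa [mul_comm]))] at this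
    exact this.false
  · intro N hN x hx
    have hxM : x ∈ M := hx
    have hxq : x < q * m := Finset.mem_range.1 (hM hxM)
    refine hN ⟨some x, ∅, atomBlock m (x / m) \ M⟩
      (mem_blockProgram.2 ⟨x, hxq, _, fun y hy => ?_,
        hcard _ (Nat.div_lt_of_lt_mul (by rwa [mul_comm])), rfl⟩) x rfl
      (fun b hb => (Finset.mem_sdiff.1 hb).2) (by simp)
    rw [Finset.mem_sdiff] at hy
    exact Finset.mem_erase.2 ⟨fun h => hy.2 (h ▸ hxM), hy.1⟩
  · intro c hc hnone
    obtain ⟨x, -, B, -, -, rfl⟩ := mem_blockProgram.1 hc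
    simp at hnone

theorem choose_pow_le_ncard_isStable_blockProgram {m k : ℕ} (hm : 0 < m) (hk : k ≤ m) (q : ℕ) :
    m.choose k ^ q ≤ {M : Finset ℕ | IsStable (blockProgram m k q) M}.ncard := by
  classical
  let F : Finset (Fin q → Finset ℕ) :=
    Fintype.piFinset fun i => (atomBlock m i).powersetCard (m - k)
  let u : (Fin q → Finset ℕ) → Finset ℕ := fun f => Finset.univ.biUnion f
  have hF : ∀ f ∈ F, ∀ i, f i ⊆ atomBlock m i ∧ (f i).card = m - k := fun f hf i =>
    Finset.mem_powersetCard.1 (Fintype.mem_piFinset.1 hf i)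
  have hinter : ∀ f ∈ F, ∀ i : Fin q, atomBlock m i ∩ u f = f i := by
    intro f hf i
    ext x
    simp only [u, Finset.mem_inter, Finset.mem_biUnion, Finset.mem_univ, true_and]
    refine ⟨?_, fun hx => ⟨(hF f hf i).1 hx, i, hx⟩⟩
    rintro ⟨hxi, j, hxj⟩
    have hj := (mem_atomBlock hm).1 ((hF f hf j).1 hxj)
    have hij : i = j := Fin.ext (((mem_atomBlock hm).1 hxi).symm.trans hj)
    exact hij ▸ hxj
  have hinj : Set.InjOn u F := fun f hf g hg hfg => funext fun i => by
    rw [← hinter f hf i, ← hinter g hg i, hfg]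
  have hcardF : F.card = m.choose k ^ q := by
    simp [F, Fintype.card_piFinset, card_atomBlock, Nat.choose_symm hk]
  rw [← hcardF, ← Finset.card_image_of_injOn hinj, ← Set.ncard_coe_finset]
  refine Set.ncard_le_ncard (fun M hM => ?_) (finite_setOf_isStable_blockProgram m k q)
  obtain ⟨f, hf, rfl⟩ := Finset.mem_image.1 (Finset.mem_coe.1 hM)
  refine isStable_blockProgram hm ?_ fun i hi => ?_
  · exact Finset.biUnion_subset.2 fun i _ =>
      (hF f hf i).1.trans (atomBlock_subset_range i.isLt)
  · have hsplit := Finset.card_sdiff_add_card_inter (atomBlock m i) (u f)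
    rw [hinter f hf ⟨i, hi⟩, (hF f hf ⟨i, hi⟩).2, card_atomBlock] at hsplit
    lia

/-- For every `t ≥ 2` there is a constant `D > 0` such that for every `n ≥ 1`
there is a definite `t`-program with at most `n` atoms having at least
`D * (2t-1 choose t) ^ (n / (2t-1))` stable models. -/
theorem stmt_10 (t : ℕ) (ht : 2 ≤ t) :
    ∃ D : ℝ, 0 < D ∧ ∀ n : ℕ, 1 ≤ n → ∃ P : LPProgram ℕ,
      (∀ c ∈ P, c.head ≠ none) ∧ IsTProgram P t ∧ P.atoms.card ≤ n ∧
      D * ((Nat.choose (2 * t - 1) t : ℝ)) ^ ((n : ℝ) / ((2 * t - 1 : ℕ) : ℝ)) ≤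
        ({M : Finset ℕ | IsStable P M}.ncard : ℝ) := by
  have hm : 0 < 2 * t - 1 := by lia
  have hchoose : (2 * t - 1).choose (t - 1) = (2 * t - 1).choose t :=
    Nat.choose_symm_of_eq_add (by lia)
  have hpos : 0 < (2 * t - 1).choose t := Nat.choose_pos (by lia)
  have hC : (1 : ℝ) ≤ (2 * t - 1).choose t := by exact_mod_cast hpos
  generalize hmdef : 2 * t - 1 = m at *
  refine ⟨((m.choose t : ℕ) : ℝ)⁻¹, by positivity, fun n _ =>
    ⟨blockProgram m (t - 1) (n / m), fun c hc => ?_, ?_, ?_, ?_⟩⟩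
  · obtain ⟨x, -, B, -, -, rfl⟩ := mem_blockProgram.1 hc
    simp
  · have h := isTProgram_blockProgram m (t - 1) (n / m)
    rwa [Nat.sub_add_cancel (by lia)] at h
  · refine (Finset.card_le_card atoms_blockProgram_subset).trans ?_
    rw [Finset.card_range]
    exact Nat.div_mul_le_self n m
  · have hcount := choose_pow_le_ncard_isStable_blockProgram hm
      (show t - 1 ≤ m by lia) (n / m)
    rw [hchoose] at hcount
    have hexp : (n : ℝ) / (m : ℝ) ≤ ((n / m + 1 : ℕ) : ℝ) := by
      rw [div_le_iff₀ (by exact_mod_cast hm)]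
      exact_mod_cast (Nat.lt_mul_of_div_lt (Nat.lt_succ_self (n / m)) hm).le
    refine le_trans ?_ (Nat.cast_le.2 hcount)
    rw [inv_mul_le_iff₀ (by linarith)]
    refine (Real.rpow_le_rpow_of_exponent_le hC hexp).trans_eq ?_
    rw [Real.rpow_natCast, pow_succ', Nat.cast_pow]
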